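/- If B ⊆ ℝ^n is s-straight, then H^s(A) ≤ |A|^s for every H^s-measurable subset A ⊆ B, where |A| denotes the diameter of A. -/

import Mathlib

open MeasureTheory
open scoped ENNReal NNReal

noncomputable def hContent {X : Type*} [EMetricSpace X] (d : ℝ) (B : Set X) : ℝ≥0∞ :=
  ⨅ (t : ℕ → Set X) (_ : B ⊆ ⋃ i, t i), ∑' i, EMetric.diam (t i) ^ d

theorem hContent_zero {X : Type*} [EMetricSpace X] (B : Set X) : hContent 0 B = ⊤ := by
  simp [hContent]

theorem hContent_le_hausdorffMeasure {X : Type*} [EMetricSpace X] [MeasurableSpace X]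
    [BorelSpace X] {d : ℝ} (hd : 0 < d) (B : Set X) : hContent d B ≤ μH[d] B := by
  rw [Measure.hausdorffMeasure_apply]
  refine le_trans ?_ (le_iSup₂ (1 : ℝ≥0∞) one_pos)
  refine le_iInf₂ fun t ht => le_iInf fun _ => ?_
  refine (iInf₂_le t ht).trans (ENNReal.tsum_le_tsum fun i => ?_)
  rcases (t i).eq_empty_or_nonempty with h | h
  · simp [h, hd, EMetric.diam]
  · exact le_iSup_of_le h le_rfl

theorem hContent_le_diam_rpow_add {X : Type*} [EMetricSpace X] (d : ℝ) {A B C : Set X}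
    (h : B ⊆ A ∪ C) : hContent d B ≤ Metric.ediam A ^ d + hContent d C := by
  conv_rhs => rw [hContent]
  simp only [ENNReal.add_iInf]
  refine le_iInf₂ fun t ht => ?_
  let u : ℕ → Set X := fun i => Nat.casesOn i A t
  refine (iInf₂_le u ?_).trans ?_
  · intro x hx
    rcases h hx with hxA | hxC
    · exact Set.mem_iUnion.2 ⟨0, hxA⟩
    · obtain ⟨i, hi⟩ := Set.mem_iUnion.1 (ht hxC)
      exact Set.mem_iUnion.2 ⟨i + 1, hi⟩
  · exact (tsum_eq_zero_add' ENNReal.summable).le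

theorem stmt3 {n : ℕ} (s : ℝ) (hs : 0 ≤ s)
    (B : Set (EuclideanSpace ℝ (Fin n)))
    (hstraight : hContent s B = μH[s] B) (hfin : μH[s] B < ⊤)
    (A : Set (EuclideanSpace ℝ (Fin n))) (hAB : A ⊆ B)
    (hA : NullMeasurableSet A μH[s]) :
    μH[s] A ≤ EMetric.diam A ^ s := by
  rcases hs.eq_or_lt with rfl | hs
  · rw [← hstraight, hContent_zero] at hfin
    exact absurd hfin (lt_irrefl _)
  have hsum : μH[s] A + μH[s] (B \ A) = μH[s] B := by
    rw [← measure_inter_add_sdiff₀ B hA, Set.inter_eq_self_of_subset_right hAB]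
  have hdiff : μH[s] (B \ A) ≠ ⊤ := ((measure_mono Set.sdiff_subset).trans_lt hfin).ne
  refine (ENNReal.add_le_add_iff_right hdiff).1 ?_
  rw [hsum, ← hstraight]
  exact (hContent_le_diam_rpow_add s (by simp)).trans
    (add_le_add_right (hContent_le_hausdorffMeasure hs _) _)
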